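/- Define g(p) = (1/5)(1−p)(4 + A(p)p) with A(p) = 2p + (1−(1−p)² + p(1−p)³)(1+(1−p)²), and h(p) = (1/3)(1−p)(1 + (1−p)³ + B(p)p) with B(p) = 3 + (1+(1−p)³)(1−(1−p)²+p(1−p)³) + p(1+(1−p)²). Then g(0) = 4/5 > 2/3 = h(0), and there exists p₀ ∈ (0,1) such that h(p) > g(p) for all p ∈ (p₀, 1). -/

import Mathlib

noncomputable def A (p : ℝ) : ℝ :=
  2*p + (1 - (1-p)^2 + p*(1-p)^3) * (1 + (1-p)^2)

noncomputable def g (p : ℝ) : ℝ := (1/5) * (1-p) * (4 + A p * p)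

noncomputable def B (p : ℝ) : ℝ :=
  3 + (1 + (1-p)^3) * (1 - (1-p)^2 + p*(1-p)^3) + p * (1 + (1-p)^2)

noncomputable def h (p : ℝ) : ℝ := (1/3) * (1-p) * (1 + (1-p)^3 + B p * p)

/-- g(0) = 4/5 > 2/3 = h(0), and h > g on some interval (p₀, 1). -/
theorem stmt_15 :
    g 0 = 4/5 ∧ (4/5 : ℝ) > 2/3 ∧ h 0 = 2/3 ∧
    ∃ p₀ : ℝ, 0 < p₀ ∧ p₀ < 1 ∧ ∀ p : ℝ, p₀ < p → p < 1 → h p > g p := by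
  refine ⟨by norm_num [g, A], by norm_num, by norm_num [h, B], 9/10, by norm_num, by norm_num, ?_⟩
  intro p hp0 hp1
  have hq0 : 0 < 1 - p := by linarith
  have hq1 : 1 - p < 1/10 := by linarith
  have hq2 : (1-p)^2 ≤ 1/100 := by nlinarith
  have hq2' : 0 ≤ (1-p)^2 := by positivity
  have hq3' : 0 ≤ (1-p)^3 := by positivity
  have hq3 : (1-p)^3 ≤ (1-p)^2 := by nlinarith
  have hpq : 0 ≤ p * (1-p)^3 := mul_nonneg (by linarith) hq3'
  have hpq' : p * (1-p)^3 ≤ (1-p)^2 := by nlinarith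
  have hA : A p ≤ 4 := by
    unfold A
    nlinarith
  have hB : 4 ≤ B p := by
    unfold B
    nlinarith [mul_nonneg hq3' (show 0 ≤ 1 - (1-p)^2 + p*(1-p)^3 by linarith),
      mul_nonneg (show 0 ≤ p by linarith) hq2']
  have hkey : (1/5) * (4 + A p * p) < (1/3) * (1 + (1-p)^3 + B p * p) := by
    have h1 : A p * p ≤ 4 * p := mul_le_mul_of_nonneg_right hA (by linarith)
    have h2 : 4 * p ≤ B p * p := mul_le_mul_of_nonneg_right hB (by linarith)
    have hA' : A p ≤ 31/10 := by
      unfold A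
      nlinarith
    have h3 : A p * p ≤ 31/10 * p := mul_le_mul_of_nonneg_right hA' (by linarith)
    linarith
  have := mul_lt_mul_of_pos_left hkey hq0
  unfold g h
  linarith
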